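/- Let q ≥ 3 be a prime power and let C be an [n,k]_q maximum weight spectrum code satisfying both property (A) and property (B). Let T = max{c[β] : c ∈ C \ {0}, β ∈ F_q \ {0}} and N = (q−1)n + (q−2) + (T+1)(q−2)(q−3)/2. Then there exists an [N, k+1]_q maximum weight spectrum code which satisfies property (B). -/

import Mathlib

/-- The Hamming weight of a vector: the number of nonzero coordinates. -/
def wt {ι F : Type*} [Fintype ι] [Zero F] [DecidableEq F] (c : ι → F) : ℕ :=
  (Finset.univ.filter fun i => c i ≠ 0).card

/-- The weight set of a code: the set of nonzero weights of nonzero codewords. -/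
def wtSet {ι F : Type*} [Fintype ι] [Zero F] [DecidableEq F] (C : Set (ι → F)) : Set ℕ :=
  {w | ∃ c ∈ C, c ≠ 0 ∧ wt c = w}

/-- `cnt c β` is the number of coordinates of `c` equal to `β` (denoted `c[β]`). -/
def cnt {ι F : Type*} [Fintype ι] [DecidableEq F] (c : ι → F) (β : F) : ℕ :=
  (Finset.univ.filter fun i => c i = β).card

/-- Property (A): there is a nonzero `β` such that the count `c[β]` separates codewords. -/
def propA {ι F : Type*} [Fintype ι] [Field F] [DecidableEq F]
    (C : Submodule F (ι → F)) : Prop :=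
  ∃ β : F, β ≠ 0 ∧ ∀ a ∈ C, ∀ b ∈ C, cnt a β = cnt b β → a = b

/-- Property (B): for every nonzero codeword `c`, the entries of the distribution vector
`V(c) = (c[α], …, c[α^(q-1)], c[0])` are pairwise distinct; since a primitive element `α`
enumerates all nonzero field elements, this says `β ↦ c[β]` is injective on `F`. -/
def propB {ι F : Type*} [Fintype ι] [Field F] [DecidableEq F]
    (C : Submodule F (ι → F)) : Prop :=
  ∀ c ∈ C, c ≠ 0 → Function.Injective fun β : F => cnt c β

theorem wt_add_cnt_zero {ι F : Type*} [Fintype ι] [Zero F] [DecidableEq F] (c : ι → F) :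
    wt c + cnt c 0 = Fintype.card ι := by
  rw [add_comm]
  exact Finset.card_filter_add_card_filter_not (s := Finset.univ) fun i => c i = 0

theorem wt_eq_zero_iff {ι F : Type*} [Fintype ι] [Zero F] [DecidableEq F] (c : ι → F) :
    wt c = 0 ↔ c = 0 := by
  simp [wt, Finset.filter_eq_empty_iff, funext_iff]

theorem cnt_le_card {ι F : Type*} [Fintype ι] [DecidableEq F] (c : ι → F) (β : F) :
    cnt c β ≤ Fintype.card ι :=
  Finset.card_le_univ _

theorem cnt_zero_of_ne {ι F : Type*} [Fintype ι] [Zero F] [DecidableEq F] {β : F} (hβ : β ≠ 0) :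
    cnt (0 : ι → F) β = 0 := by
  simp [cnt, hβ.symm]

theorem cnt_zero_zero {ι F : Type*} [Fintype ι] [Zero F] [DecidableEq F] :
    cnt (0 : ι → F) 0 = Fintype.card ι := by
  simp [cnt]

theorem cnt_comp_equiv {ι κ F : Type*} [Fintype ι] [Fintype κ] [DecidableEq F] (e : κ ≃ ι)
    (c : ι → F) (β : F) : cnt (c ∘ e) β = cnt c β := by
  simp only [cnt, ← Fintype.card_subtype]
  exact Fintype.card_congr (e.subtypeEquiv fun _ => Iff.rfl)

theorem cnt_sumElim {ι κ F : Type*} [Fintype ι] [Fintype κ] [DecidableEq F] (a : ι → F)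
    (b : κ → F) (β : F) : cnt (Sum.elim a b) β = cnt a β + cnt b β := by
  simp only [cnt, Finset.card_filter, Fintype.sum_sum_type, Sum.elim_inl, Sum.elim_inr]
  congr!

theorem cnt_sigma_fst {F : Type*} [Fintype F] [DecidableEq F] (w : F → ℕ) (β : F) :
    cnt (fun p : Σ x : F, Fin (w x) => p.1) β = w β := by
  simp only [cnt, Finset.card_filter, Fintype.sum_sigma]
  simp [apply_ite Finset.card]

theorem cnt_sub_const {ι F : Type*} [Fintype ι] [AddGroup F] [DecidableEq F] (c : ι → F)
    (γ β : F) : cnt (fun i => c i - γ) β = cnt c (β + γ) := by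
  simp [cnt, sub_eq_iff_eq_add]

theorem cnt_smul {ι F : Type*} [Fintype ι] [Field F] [DecidableEq F] {a : F} (ha : a ≠ 0)
    (c : ι → F) (β : F) : cnt (a • c) β = cnt c (a⁻¹ * β) := by
  simp [cnt, eq_inv_mul_iff_mul_eq₀ ha]

theorem wt_smul {ι F : Type*} [Fintype ι] [Field F] [DecidableEq F] {a : F} (ha : a ≠ 0)
    (c : ι → F) : wt (a • c) = wt c := by
  simp [wt, ha]

/-- Ranks of the elements of a finite set: an injection with values `0, …, s.card - 1`. -/
theorem Finset.exists_rank {α : Type*} [DecidableEq α] (s : Finset α) :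
    ∃ r : α → ℕ, Set.InjOn r s ∧
      ∀ f : ℕ → ℕ, ∑ x ∈ s, f (r x) = ∑ i ∈ Finset.range s.card, f i := by
  refine ⟨fun x => if h : x ∈ s then s.equivFin ⟨x, h⟩ else 0, ?_, fun f => ?_⟩
  · intro x hx y hy hxy
    have hx' : x ∈ s := hx
    have hy' : y ∈ s := hy
    simpa [hx', hy', Fin.val_inj] using hxy
  · rw [← Finset.sum_coe_sort, ← Fin.sum_univ_eq_sum_range, ← s.equivFin.sum_comp]
    simp

/-- Multiplicities `a, a + (T + 1), a + 2 (T + 1), …` assigned to the elements of `s`. -/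
theorem exists_spaced_multiplicity {α : Type*} [Fintype α] [DecidableEq α] (s : Finset α)
    (a T : ℕ) :
    ∃ w : α → ℕ, (∀ x ∉ s, w x = 0) ∧ (∀ x ∈ s, a ≤ w x) ∧
      (∀ x ∈ s, ∀ y ∈ s, x ≠ y → w x + T < w y ∨ w y + T < w x) ∧
      ∑ x, w x = s.card * a + (T + 1) * (s.card * (s.card - 1) / 2) := by
  obtain ⟨r, hr, hsum⟩ := s.exists_rank
  refine ⟨fun x => if x ∈ s then a + (T + 1) * r x else 0, ?_, ?_, ?_, ?_⟩
  · intro x hx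
    simp [hx]
  · intro x hx
    simp [hx]
  · intro x hx y hy hxy
    simp only [hx, hy, if_true]
    rcases lt_or_gt_of_ne (fun h => hxy (hr hx hy h)) with h | h
    · left; nlinarith
    · right; nlinarith
  · rw [Finset.sum_ite_mem, Finset.univ_inter, hsum fun i => a + (T + 1) * i,
      Finset.sum_add_distrib, ← Finset.mul_sum, Finset.sum_range_id]
    simp

theorem card_eq_of_equiv_sum_sigma {κ F : Type*} [Fintype κ] [Fintype F] {n : ℕ}
    (w : F → ℕ) (e : κ ≃ Fin n ⊕ Σ x : F, Fin (w x)) :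
    Fintype.card κ = n + ∑ x, w x := by
  simp [Fintype.card_congr e]

section Extension

variable {κ F : Type*} [Field F] {n : ℕ}

/-- The map `(c, a) ↦ (c - aβ, a x, …)` where each `x : F` occurs `w x` times in the tail. -/
def extendMap (C : Submodule F (Fin n → F)) (β : F) (w : F → ℕ)
    (e : κ ≃ Fin n ⊕ Σ x : F, Fin (w x)) : (C × F) →ₗ[F] (κ → F) where
  toFun p := Sum.elim (fun i => p.1.1 i - p.2 * β) (fun t => p.2 * t.1) ∘ e
  map_add' p p' := by
    ext i
    rcases h : e i with j | t <;> simp [h] <;> ring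
  map_smul' a p := by
    ext i
    rcases h : e i with j | t <;> simp [h] <;> ring

variable (C : Submodule F (Fin n → F)) (β : F) (w : F → ℕ)
  (e : κ ≃ Fin n ⊕ Σ x : F, Fin (w x))

theorem extendMap_eq_smul (c : C) {a : F} (ha : a ≠ 0) :
    extendMap C β w e (c, a) = a • extendMap C β w e (a⁻¹ • c, 1) := by
  rw [← map_smul, Prod.smul_mk, smul_inv_smul₀ ha, smul_eq_mul, mul_one]

variable [Fintype κ] [Fintype F] [DecidableEq F]

theorem cnt_extendMap_one (c : C) (x : F) :
    cnt (extendMap C β w e (c, 1)) x = cnt c.1 (x + β) + w x := by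
  simp [extendMap, cnt_comp_equiv, cnt_sumElim, cnt_sub_const, cnt_sigma_fst]

theorem cnt_extendMap_zero_of_ne (c : C) {x : F} (hx : x ≠ 0) :
    cnt (extendMap C β w e (c, 0)) x = cnt c.1 x := by
  have := cnt_zero_of_ne (ι := Σ x : F, Fin (w x)) hx
  simpa [extendMap, cnt_comp_equiv, cnt_sumElim, ← Pi.zero_def] using this

theorem cnt_extendMap_zero_zero (c : C) :
    cnt (extendMap C β w e (c, 0)) 0 = cnt c.1 0 + ∑ x, w x := by
  have := cnt_zero_zero (ι := Σ x : F, Fin (w x)) (F := F)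
  simpa [extendMap, cnt_comp_equiv, cnt_sumElim, ← Pi.zero_def] using this

theorem wt_extendMap_zero (c : C) : wt (extendMap C β w e (c, 0)) = wt c.1 := by
  have h₁ := wt_add_cnt_zero (extendMap C β w e (c, 0))
  have h₂ := wt_add_cnt_zero c.1
  rw [cnt_extendMap_zero_zero, card_eq_of_equiv_sum_sigma w e] at h₁
  rw [Fintype.card_fin] at h₂
  omega

theorem wt_extendMap_one (hw : w 0 = 0) (c : C) :
    wt (extendMap C β w e (c, 1)) + cnt c.1 β = n + ∑ x, w x := by
  have h := wt_add_cnt_zero (extendMap C β w e (c, 1))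
  rwa [cnt_extendMap_one, card_eq_of_equiv_sum_sigma w e, zero_add, hw, add_zero] at h

theorem lt_wt_extendMap_one (hw : w 0 = 0) (hn : n < ∑ x, w x) (c : C) :
    n < wt (extendMap C β w e (c, 1)) := by
  have h₁ := wt_extendMap_one C β w e hw c
  have h₂ := cnt_le_card c.1 β
  rw [Fintype.card_fin] at h₂
  omega

theorem extendMap_injective (hw : w 0 = 0) (hn : n < ∑ x, w x) :
    Function.Injective (extendMap C β w e) := by
  rw [← LinearMap.ker_eq_bot, LinearMap.ker_eq_bot']
  rintro ⟨c, a⟩ h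
  by_cases ha : a = 0
  · subst ha
    have h₁ := wt_extendMap_zero C β w e c
    rw [h, (wt_eq_zero_iff _).2 rfl, eq_comm, wt_eq_zero_iff] at h₁
    exact Prod.ext (Subtype.ext h₁) rfl
  · rw [extendMap_eq_smul C β w e c ha, smul_eq_zero_iff_right ha] at h
    have h₁ := lt_wt_extendMap_one C β w e hw hn (a⁻¹ • c)
    rw [h, (wt_eq_zero_iff _).2 rfl] at h₁
    omega

theorem finrank_range_extendMap (hw : w 0 = 0) (hn : n < ∑ x, w x) :
    Module.finrank F (LinearMap.range (extendMap C β w e)) = Module.finrank F C + 1 := by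
  rw [LinearMap.finrank_range_of_inj (extendMap_injective C β w e hw hn), Module.finrank_prod,
    Module.finrank_self]

theorem wtSet_range_extendMap (hw : w 0 = 0) (hn : n < ∑ x, w x) :
    wtSet (LinearMap.range (extendMap C β w e) : Set (κ → F)) =
      wtSet (C : Set (Fin n → F)) ∪ Set.range fun c : C => wt (extendMap C β w e (c, 1)) := by
  have hinj := extendMap_injective C β w e hw hn
  ext m
  constructor
  · rintro ⟨_, ⟨⟨c, a⟩, rfl⟩, hne, rfl⟩
    by_cases ha : a = 0
    · subst ha
      refine Or.inl ⟨c, c.2, fun h => hne ?_, (wt_extendMap_zero C β w e c).symm⟩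
      rw [← wt_eq_zero_iff, wt_extendMap_zero, wt_eq_zero_iff, h]
    · refine Or.inr ⟨a⁻¹ • c, ?_⟩
      rw [extendMap_eq_smul C β w e c ha, wt_smul ha]
  · rintro (⟨c, hc, hne, rfl⟩ | ⟨c, rfl⟩)
    · refine ⟨_, ⟨(⟨c, hc⟩, 0), rfl⟩, fun h => hne ?_, wt_extendMap_zero C β w e ⟨c, hc⟩⟩
      have := hinj (h.trans (map_zero _).symm)
      simpa using this
    · refine ⟨_, ⟨(c, 1), rfl⟩, fun h => ?_, rfl⟩
      have := hinj (h.trans (map_zero _).symm)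
      simp at this

theorem ncard_wtSet_range_extendMap (hw : w 0 = 0) (hn : n < ∑ x, w x)
    (hβ : ∀ a ∈ C, ∀ b ∈ C, cnt a β = cnt b β → a = b) :
    (wtSet (LinearMap.range (extendMap C β w e) : Set (κ → F))).ncard =
      (wtSet (C : Set (Fin n → F))).ncard + Fintype.card F ^ Module.finrank F C := by
  have hle : ∀ m ∈ wtSet (C : Set (Fin n → F)), m ≤ n := by
    rintro _ ⟨c, -, -, rfl⟩
    have := wt_add_cnt_zero c
    rw [Fintype.card_fin] at this
    omega
  rw [wtSet_range_extendMap C β w e hw hn, Set.ncard_union_eq _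
    ((Set.finite_Iic n).subset hle) (Set.finite_range _), ← Set.image_univ,
    Set.ncard_image_of_injective, Set.ncard_univ, Module.natCard_eq_pow_finrank (K := F),
    Nat.card_eq_fintype_card]
  · intro c c' h
    have h₁ := wt_extendMap_one C β w e hw c
    have h₂ := wt_extendMap_one C β w e hw c'
    simp only at h
    exact Subtype.ext (hβ _ c.2 _ c'.2 (by omega))
  · rw [Set.disjoint_left]
    rintro m hm ⟨c, rfl⟩
    have h₁ := hle _ hm
    have h₂ := lt_wt_extendMap_one C β w e hw hn c
    simp only at h₁
    omega

/-- Property (B) for the extension, when the tail multiplicities outside `{0, -β}` exceed `n` and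
are pairwise more than `T` apart. -/
theorem propB_range_extendMap {T : ℕ} (hn0 : 0 < n) (hn : n < ∑ x, w x) (hβ : β ≠ 0)
    (hB : propB C) (hT : ∀ c ∈ C, ∀ x : F, x ≠ 0 → cnt c x ≤ T)
    (hw : w 0 = 0) (hw' : w (-β) = 0) (hlarge : ∀ x, x ≠ 0 → x ≠ -β → n < w x)
    (hsep : ∀ x y, x ≠ 0 → x ≠ -β → y ≠ 0 → y ≠ -β → x ≠ y →
      w x + T < w y ∨ w y + T < w x) :
    propB (LinearMap.range (extendMap C β w e)) := by
  have hcard : ∀ (c : Fin n → F) x, cnt c x ≤ n := fun c x => by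
    simpa using cnt_le_card c x
  have hone : ∀ c : C, Function.Injective (cnt (extendMap C β w e (c, 1))) := by
    intro c x y hxy
    rw [cnt_extendMap_one, cnt_extendMap_one] at hxy
    have hends : cnt c.1 β ≠ cnt c.1 0 := by
      intro h
      by_cases hc : c.1 = 0
      · rw [hc, cnt_zero_of_ne hβ, cnt_zero_zero, Fintype.card_fin] at h
        omega
      · exact hβ (hB c.1 c.2 hc h)
    have hshift : ∀ z, z ≠ -β → z + β ≠ 0 := fun z hz h => hz (eq_neg_of_add_eq_zero_left h)
    have hx := hcard c.1 (x + β)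
    have hy := hcard c.1 (y + β)
    by_cases hx0 : x = 0 ∨ x = -β <;> by_cases hy0 : y = 0 ∨ y = -β
    · rcases hx0 with rfl | rfl <;> rcases hy0 with rfl | rfl <;>
        simp_all [eq_comm]
    · rw [not_or] at hy0
      have := hlarge y hy0.1 hy0.2
      have : w x = 0 := by rcases hx0 with rfl | rfl <;> assumption
      omega
    · rw [not_or] at hx0
      have := hlarge x hx0.1 hx0.2
      have : w y = 0 := by rcases hy0 with rfl | rfl <;> assumption
      omega
    · rw [not_or] at hx0 hy0
      by_contra hne
      have h₁ := hT c.1 c.2 _ (hshift x hx0.2)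
      have h₂ := hT c.1 c.2 _ (hshift y hy0.2)
      have := hsep x y hx0.1 hx0.2 hy0.1 hy0.2 hne
      omega
  rintro _ ⟨⟨c, a⟩, rfl⟩ hne x y hxy
  simp only at hxy
  by_cases ha : a = 0
  · subst ha
    have hc : c.1 ≠ 0 := by
      intro h
      apply hne
      rw [← wt_eq_zero_iff, wt_extendMap_zero, wt_eq_zero_iff, h]
    have hx := hcard c.1 x
    have hy := hcard c.1 y
    by_cases hx0 : x = 0 <;> by_cases hy0 : y = 0
    · rw [hx0, hy0]
    · rw [hx0, cnt_extendMap_zero_zero, cnt_extendMap_zero_of_ne _ _ _ _ _ hy0] at hxy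
      omega
    · rw [hy0, cnt_extendMap_zero_zero, cnt_extendMap_zero_of_ne _ _ _ _ _ hx0] at hxy
      omega
    · rw [cnt_extendMap_zero_of_ne _ _ _ _ _ hx0, cnt_extendMap_zero_of_ne _ _ _ _ _ hy0] at hxy
      exact hB c.1 c.2 hc hxy
  · rw [extendMap_eq_smul C β w e c ha, cnt_smul ha, cnt_smul ha] at hxy
    exact mul_left_cancel₀ (inv_ne_zero ha) (hone _ hxy)

end Extension

/-- Let `q ≥ 3` be a prime power and `C` an `[n,k]_q` MWS code satisfying properties (A)
and (B). With `T = max{c[β] : c ∈ C \ {0}, β ≠ 0}` and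
`N = (q-1)n + (q-2) + (T+1)(q-2)(q-3)/2`, there exists an `[N,k+1]_q` MWS code
satisfying property (B). -/
theorem MWS_propAB_extend (q n k T : ℕ) (hq : IsPrimePow q) (hq3 : 3 ≤ q)
    (F : Type*) [Field F] [Fintype F] [DecidableEq F] (hcard : Fintype.card F = q)
    (C : Submodule F (Fin n → F)) (hdim : Module.finrank F C = k)
    (hMWS : (wtSet (C : Set (Fin n → F))).ncard = (q ^ k - 1) / (q - 1))
    (hA : propA C) (hB : propB C)
    (hT : IsGreatest {m : ℕ | ∃ c ∈ C, c ≠ 0 ∧ ∃ β : F, β ≠ 0 ∧ cnt c β = m} T) :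
    ∃ D : Submodule F (Fin ((q - 1) * n + (q - 2) + (T + 1) * ((q - 2) * (q - 3) / 2)) → F),
      Module.finrank F D = k + 1 ∧
      (wtSet (D : Set (Fin ((q - 1) * n + (q - 2) + (T + 1) * ((q - 2) * (q - 3) / 2)) → F))).ncard
        = (q ^ (k + 1) - 1) / (q - 1) ∧
      propB D := by
  subst hcard hdim
  obtain ⟨β, hβ, hsep⟩ := hA
  obtain ⟨⟨c₀, -, hc₀, -⟩, hTmax⟩ := hT
  have hn0 : 0 < n := by
    rcases Nat.eq_zero_or_pos n with rfl | h
    · exact absurd (Subsingleton.elim c₀ 0) hc₀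
    · exact h
  have hT' : ∀ c ∈ C, ∀ x : F, x ≠ 0 → cnt c x ≤ T := by
    intro c hc x hx
    by_cases h : c = 0
    · rw [h, cnt_zero_of_ne hx]
      exact Nat.zero_le _
    · exact hTmax ⟨c, hc, h, x, hx, rfl⟩
  let s : Finset F := {0, -β}ᶜ
  have hs : ∀ x, x ∈ s ↔ x ≠ 0 ∧ x ≠ -β := by simp [s]
  have hscard : s.card = Fintype.card F - 2 := by
    rw [Finset.card_compl, Finset.card_pair (neg_ne_zero.2 hβ).symm]
  obtain ⟨w, hw0, hwlarge, hwsep, hwsum⟩ := exists_spaced_multiplicity s (n + 1) T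
  rw [hscard] at hwsum
  have hn : n < ∑ x, w x := by
    have : 1 * (n + 1) ≤ (Fintype.card F - 2) * (n + 1) :=
      Nat.mul_le_mul_right _ (by omega)
    omega
  have hcard : Fintype.card (Fin n ⊕ Σ x : F, Fin (w x)) = (Fintype.card F - 1) * n +
      (Fintype.card F - 2) +
      (T + 1) * ((Fintype.card F - 2) * (Fintype.card F - 3) / 2) := by
    rw [Fintype.card_sum, Fintype.card_sigma, Fintype.card_fin]
    simp only [Fintype.card_fin]
    rw [hwsum, Nat.sub_sub, show Fintype.card F - 1 = (Fintype.card F - 2) + 1 by omega]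
    ring
  let e := (Fintype.equivFinOfCardEq hcard).symm
  have hw : w 0 = 0 := hw0 0 (by simp [s])
  refine ⟨LinearMap.range (extendMap C β w e), finrank_range_extendMap C β w e hw hn, ?_, ?_⟩
  · rw [ncard_wtSet_range_extendMap C β w e hw hn hsep, hMWS]
    simp only [← Nat.geomSum_eq (m := Fintype.card F) (by omega), Finset.sum_range_succ]
  · exact propB_range_extendMap C β w e hn0 hn hβ hB hT' hw (hw0 _ (by simp [s]))
      (fun x h₁ h₂ => hwlarge x ((hs x).2 ⟨h₁, h₂⟩))
      (fun x y h₁ h₂ h₃ h₄ => hwsep x ((hs x).2 ⟨h₁, h₂⟩) y ((hs y).2 ⟨h₃, h₄⟩))
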